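/- Every smallest counterexample has girth at least 5, i.e., contains no cycle of length 3 or 4. -/

import Mathlib

open SimpleGraph

/-- The degree of a vertex, as the cardinality of its neighbor set. -/
noncomputable def deg {V : Type} (G : SimpleGraph V) (v : V) : ℕ :=
  (G.neighborSet v).ncard

/-- The potential of a finite graph: `5 n(G) - 4 e(G)`. -/
noncomputable def pot {V : Type} [Fintype V] (G : SimpleGraph V) : ℤ :=
  5 * (Fintype.card V : ℤ) - 4 * (G.edgeSet.ncard : ℤ)

/-- A graph is 5/2-critical if it has no homomorphism to the 5-cycle
but every proper subgraph has one. -/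
def Critical52 {V : Type} (G : SimpleGraph V) : Prop :=
  IsEmpty (G →g cycleGraph 5) ∧
  ∀ H : G.Subgraph, H ≠ ⊤ → Nonempty (H.coe →g cycleGraph 5)

/-- The exceptional graph `E₁`: a 9-cycle `0 1 2 3 4 5 6 7 8` together
with a vertex `9` adjacent to `0`, `3` and `6`. -/
def E1 : SimpleGraph (Fin 10) := SimpleGraph.fromEdgeSet
  {s(0,1), s(1,2), s(2,3), s(3,4), s(4,5), s(5,6), s(6,7), s(7,8), s(8,0),
   s(9,0), s(9,3), s(9,6)}

/-- The exceptional graph `E₂`: two 5-cycles `0 1 2 3 4` and `0 1 5 6 7`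
sharing exactly the edge `01`, together with a path `3 8 9 6`. -/
def E2 : SimpleGraph (Fin 10) := SimpleGraph.fromEdgeSet
  {s(0,1), s(1,2), s(2,3), s(3,4), s(4,0),
   s(1,5), s(5,6), s(6,7), s(7,0),
   s(3,8), s(8,9), s(9,6)}

/-- A smallest counterexample: a 5/2-critical graph, not isomorphic to `C₃`, `E₁`, `E₂`,
with potential at least 2, such that every smaller 5/2-critical graph not isomorphic
to `C₃`, `E₁`, `E₂` has potential at most 1. -/
def SmallestCex {V : Type} [Fintype V] (G : SimpleGraph V) : Prop :=
  Critical52 G ∧ IsEmpty (G ≃g cycleGraph 3) ∧ IsEmpty (G ≃g E1) ∧ IsEmpty (G ≃g E2) ∧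
  2 ≤ pot G ∧
  ∀ (m : ℕ) (H : SimpleGraph (Fin m)), Critical52 H →
    IsEmpty (H ≃g cycleGraph 3) → IsEmpty (H ≃g E1) → IsEmpty (H ≃g E2) →
    m < Fintype.card V → pot H ≤ 1

/-- A string: a path of positive length whose endvertices have degree at least 3
and whose internal vertices have degree 2. A `k`-string is a string of length `k+1`. -/
def IsString {V : Type} (G : SimpleGraph V) {u v : V} (p : G.Walk u v) : Prop :=
  p.IsPath ∧ 0 < p.length ∧ 3 ≤ deg G u ∧ 3 ≤ deg G v ∧
  ∀ w ∈ p.support, w ≠ u → w ≠ v → deg G w = 2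

/-- `v` lies on a 5-cycle of `G`. -/
def InFiveCycle {V : Type} (G : SimpleGraph V) (v : V) : Prop :=
  ∃ (w : V) (c : G.Walk w w), c.IsCycle ∧ c.length = 5 ∧ v ∈ c.support

/-- `v` is a `(k₁,k₂,k₃)`-vertex: it has degree 3 and is the end of a `k₁`-string,
a `k₂`-string and a `k₃`-string leaving `v` through its three distinct edges. -/
def IsVertex3 {V : Type} (G : SimpleGraph V) (v : V) (k1 k2 k3 : ℕ) : Prop :=
  deg G v = 3 ∧ ∃ (u1 u2 u3 : V) (p1 : G.Walk v u1) (p2 : G.Walk v u2) (p3 : G.Walk v u3),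
    IsString G p1 ∧ IsString G p2 ∧ IsString G p3 ∧
    p1.getVert 1 ≠ p2.getVert 1 ∧ p1.getVert 1 ≠ p3.getVert 1 ∧ p2.getVert 1 ≠ p3.getVert 1 ∧
    p1.length = k1 + 1 ∧ p2.length = k2 + 1 ∧ p3.length = k3 + 1

/-- `v` is a `(k₁,k₂,k₃,k₄)`-vertex: it has degree 4 and is the end of strings of the
corresponding lengths leaving `v` through its four distinct edges. -/
def IsVertex4 {V : Type} (G : SimpleGraph V) (v : V) (k1 k2 k3 k4 : ℕ) : Prop :=
  deg G v = 4 ∧ ∃ (u1 u2 u3 u4 : V) (p1 : G.Walk v u1) (p2 : G.Walk v u2)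
    (p3 : G.Walk v u3) (p4 : G.Walk v u4),
    IsString G p1 ∧ IsString G p2 ∧ IsString G p3 ∧ IsString G p4 ∧
    p1.getVert 1 ≠ p2.getVert 1 ∧ p1.getVert 1 ≠ p3.getVert 1 ∧ p1.getVert 1 ≠ p4.getVert 1 ∧
    p2.getVert 1 ≠ p3.getVert 1 ∧ p2.getVert 1 ≠ p4.getVert 1 ∧ p3.getVert 1 ≠ p4.getVert 1 ∧
    p1.length = k1 + 1 ∧ p2.length = k2 + 1 ∧ p3.length = k3 + 1 ∧ p4.length = k4 + 1

/-- `H` contains at least two distinct cycles, where cycles are counted as subgraphs,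
i.e. two cycles are distinct if their edge sets differ. -/
def TwoDistinctCycles {V : Type} (H : SimpleGraph V) : Prop :=
  ∃ (v1 v2 : V) (c1 : H.Walk v1 v1) (c2 : H.Walk v2 v2),
    c1.IsCycle ∧ c2.IsCycle ∧ {e | e ∈ c1.edges} ≠ {e | e ∈ c2.edges}

/-- The degree of a 5-cycle (cell) `c` in `G`: the number of strings not contained in `c`
that intersect `c`, strings being counted by their edge sets. -/
noncomputable def cellDegree {V : Type} (G : SimpleGraph V) {w : V} (c : G.Walk w w) : ℕ :=
  {S : Set (Sym2 V) | ∃ (u v : V) (p : G.Walk u v), IsString G p ∧ S = {e | e ∈ p.edges} ∧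
    ¬ S ⊆ {e | e ∈ c.edges} ∧ ∃ x ∈ p.support, x ∈ c.support}.ncard

/-- The edges of `K` with both ends in `S`. -/
noncomputable def edgesIn {V : Type} [Fintype V] (K : SimpleGraph V) (S : Finset V) :
    Finset (Sym2 V) := by
  classical
  exact Finset.univ.filter (fun e => e ∈ K.edgeSet ∧ ∀ x ∈ e, x ∈ S)

theorem mem_edgesIn {V : Type} [Fintype V] (K : SimpleGraph V) (S : Finset V) (e : Sym2 V) :
    e ∈ edgesIn K S ↔ e ∈ K.edgeSet ∧ ∀ x ∈ e, x ∈ S := by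
  simp [edgesIn]

theorem mk_mem_edgesIn {V : Type} [Fintype V] (K : SimpleGraph V) (S : Finset V) (u v : V) :
    s(u, v) ∈ edgesIn K S ↔ K.Adj u v ∧ u ∈ S ∧ v ∈ S := by
  simp [mem_edgesIn]

theorem card_edgesIn_univ {V : Type} [Fintype V] (K : SimpleGraph V) :
    (edgesIn K Finset.univ).card = K.edgeSet.ncard := by
  rw [← Set.ncard_coe_finset]
  congr 1
  ext e
  simp [mem_edgesIn]

/-- potential of an induced subgraph -/
noncomputable def potIn {V : Type} [Fintype V] (K : SimpleGraph V) (S : Finset V) : ℤ :=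
  5 * (S.card : ℤ) - 4 * ((edgesIn K S).card : ℤ)

theorem potIn_univ {V : Type} [Fintype V] (K : SimpleGraph V) :
    potIn K Finset.univ = pot K := by
  simp [potIn, pot, card_edgesIn_univ]

theorem c5_count : ∀ Y : Finset (Fin 5), Y.Nonempty →
    4 * ((Finset.univ : Finset (Sym2 (Fin 5))).filter
      (fun e => e ∈ (cycleGraph 5).edgeSet ∧ ∀ x ∈ e, x ∈ Y)).card + 5 ≤ 5 * Y.card := by
  set_option maxRecDepth 100000 in decide

theorem potIn_ge_five {V : Type} [Fintype V] (K : SimpleGraph V) (S : Finset V)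
    (hS : S.Nonempty) (φ : V → Fin 5) (hinj : Set.InjOn φ S)
    (hφ : ∀ u ∈ S, ∀ v ∈ S, K.Adj u v → (cycleGraph 5).Adj (φ u) (φ v)) :
    5 ≤ potIn K S := by
  classical
  have h1 := c5_count (S.image φ) (hS.image φ)
  rw [Finset.card_image_of_injOn hinj] at h1
  have h2 : (edgesIn K S).card ≤ ((Finset.univ : Finset (Sym2 (Fin 5))).filter
      (fun e => e ∈ (cycleGraph 5).edgeSet ∧ ∀ x ∈ e, x ∈ S.image φ)).card := by
    apply Finset.card_le_card_of_injOn (Sym2.map φ)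
    · intro e
      induction e using Sym2.ind with
      | _ u v =>
        intro he
        have he' := (mk_mem_edgesIn K S u v).1 he
        simp only [Sym2.map_mk, Finset.coe_filter, Set.mem_ofPred_eq, Finset.mem_univ, true_and,
          SimpleGraph.mem_edgeSet]
        refine ⟨hφ u he'.2.1 v he'.2.2 he'.1, ?_⟩
        intro x hx
        rcases Sym2.mem_iff.1 hx with rfl | rfl
        · exact Finset.mem_image_of_mem _ he'.2.1
        · exact Finset.mem_image_of_mem _ he'.2.2
    · intro e he e' he'
      induction e using Sym2.ind with
      | _ u v =>
      induction e' using Sym2.ind with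
      | _ u' v' =>
        have a := (mk_mem_edgesIn K S u v).1 he
        have b := (mk_mem_edgesIn K S u' v').1 he'
        intro hh
        simp only [Sym2.map_mk, Sym2.eq_iff] at hh ⊢
        rcases hh with ⟨x, y⟩ | ⟨x, y⟩
        · exact Or.inl ⟨hinj a.2.1 b.2.1 x, hinj a.2.2 b.2.2 y⟩
        · exact Or.inr ⟨hinj a.2.1 b.2.2 x, hinj a.2.2 b.2.1 y⟩
  unfold potIn
  zify at h1 h2
  have : ((edgesIn K S).card : ℤ) ≤ _ := h2
  have h3 := h1
  linarith

theorem critical_color {V : Type} [Fintype V] {G : SimpleGraph V} (hG : Critical52 G)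
    (S : Finset V) (hS : S ≠ Finset.univ) :
    ∃ φ : V → Fin 5, ∀ u ∈ S, ∀ v ∈ S, G.Adj u v → (cycleGraph 5).Adj (φ u) (φ v) := by
  classical
  have hne : (⊤ : G.Subgraph).induce (S : Set V) ≠ ⊤ := by
    intro hh
    apply hS
    have := congrArg SimpleGraph.Subgraph.verts hh
    simpa using this
  obtain ⟨ψ⟩ := hG.2 _ hne
  refine ⟨fun v => if hv : v ∈ S then ψ ⟨v, by simpa using hv⟩ else 0, ?_⟩
  intro u hu v hv huv
  simp only [hu, hv, dif_pos]
  apply ψ.map_rel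
  simp [hu, hv, huv]

theorem critical_nondom {V : Type} [Fintype V] {G : SimpleGraph V} (hG : Critical52 G)
    (x y : V) (hxy : x ≠ y) : ∃ w, G.Adj x w ∧ ¬ G.Adj y w := by
  classical
  by_contra! hcon
  obtain ⟨φ, hφ⟩ := critical_color hG (Finset.univ.erase x) (by simp)
  refine hG.1.false ⟨fun v => if v = x then φ y else φ v, ?_⟩
  intro u v huv
  have hne := huv.ne
  by_cases hu : u = x
  · subst hu
    simp only [if_true, if_neg hne.symm]
    exact hφ _ (by simp [hxy.symm]) _ (by simp [hne.symm]) (hcon v huv)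
  · by_cases hv : v = x
    · subst hv
      simp only [if_true, if_neg hu]
      exact hφ _ (by simp [hu]) _ (by simp [hxy.symm]) (hcon u huv.symm).symm
    · simp only [if_neg hu, if_neg hv]
      exact hφ _ (by simp [hu]) _ (by simp [hv]) huv

/-- Transport an induced copy to `Fin`. -/
theorem exists_critical {W : Type} [Fintype W] (G' : SimpleGraph W)
    (hno : IsEmpty (G' →g cycleGraph 5)) :
    ∃ (m : ℕ) (H : SimpleGraph (Fin m)) (ι : Fin m → W), Function.Injective ι ∧
      (∀ i j, H.Adj i j → G'.Adj (ι i) (ι j)) ∧ Critical52 H := by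
  classical
  let P : ℕ → Prop := fun k => ∃ (m : ℕ) (H : SimpleGraph (Fin m)) (ι : Fin m → W),
    Function.Injective ι ∧ (∀ i j, H.Adj i j → G'.Adj (ι i) (ι j)) ∧
    IsEmpty (H →g cycleGraph 5) ∧ m + H.edgeSet.ncard = k
  have key : ∀ (A : Type) [Fintype A] (K : SimpleGraph A) (κ : A → W),
      Function.Injective κ → (∀ i j, K.Adj i j → G'.Adj (κ i) (κ j)) →
      IsEmpty (K →g cycleGraph 5) → P (Fintype.card A + K.edgeSet.ncard) := by
    intro A _ K κ hκ hK hK'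
    let e := (Fintype.equivFin A).symm
    let I : K.comap e ≃g K := SimpleGraph.Iso.comap e K
    refine ⟨Fintype.card A, K.comap e, κ ∘ e, hκ.comp e.injective, ?_, ?_, ?_⟩
    · intro i j hij
      exact hK _ _ hij
    · constructor
      intro f
      exact hK'.false (f.comp I.symm.toHom)
    · congr 1
      rw [← Nat.card_coe_set_eq, ← Nat.card_coe_set_eq]
      exact Nat.card_congr I.mapEdgeSet
  have hex : ∃ k, P k := ⟨_, key W G' id Function.injective_id (fun _ _ h => h) hno⟩
  obtain ⟨m, H, ι, hι, hH, hH', hk⟩ := Nat.find_spec hex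
  refine ⟨m, H, ι, hι, hH, hH', ?_⟩
  intro K hK
  by_contra hcon
  rw [not_nonempty_iff] at hcon
  have := key K.verts K.coe (fun x => ι x.1) (hι.comp Subtype.val_injective)
    (fun i j hij => hH _ _ (K.adj_sub hij)) hcon
  have hmin := Nat.find_min' hex this
  rw [← hk] at hmin
  have hv : Fintype.card K.verts ≤ m := by
    simpa using Fintype.card_subtype_le (fun x => x ∈ K.verts)
  have hE : K.coe.edgeSet.ncard ≤ K.edgeSet.ncard := by
    refine Set.ncard_le_ncard_of_injOn (Sym2.map Subtype.val) ?_ ?_ (Set.toFinite _)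
    · intro e
      induction e using Sym2.ind with
      | _ u v => intro h; simpa using h
    · exact (Sym2.map.injective Subtype.val_injective).injOn
  have hE2 : K.edgeSet.ncard ≤ H.edgeSet.ncard :=
    Set.ncard_le_ncard K.edgeSet_subset (Set.toFinite _)
  apply hK
  have hv' : Fintype.card K.verts = m := by omega
  have hE' : H.edgeSet.ncard ≤ K.edgeSet.ncard := by omega
  have hEE : K.edgeSet = H.edgeSet :=
    Set.eq_of_subset_of_ncard_le K.edgeSet_subset hE' (Set.toFinite _)
  have hVV : K.verts = Set.univ := by
    apply Set.eq_of_subset_of_ncard_le (Set.subset_univ _) _ (Set.toFinite _)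
    rw [Set.ncard_univ, ← Nat.card_coe_set_eq, Nat.card_eq_fintype_card, Nat.card_eq_fintype_card,
      hv']
    simp
  ext u v
  · simp [hVV]
  · rw [← SimpleGraph.Subgraph.mem_edgeSet, hEE]
    simp

theorem pot_iso {V W : Type} [Fintype V] [Fintype W] {G : SimpleGraph V} {H : SimpleGraph W}
    (I : G ≃g H) : pot G = pot H := by
  unfold pot
  rw [Fintype.card_congr I.toEquiv, ← Nat.card_coe_set_eq, ← Nat.card_coe_set_eq,
    Nat.card_congr I.mapEdgeSet]

theorem pot_C3 : pot (cycleGraph 3) = 3 := by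
  have : (cycleGraph 3).edgeSet.ncard = 3 := by
    rw [Set.ncard_eq_toFinset_card']
    decide
  simp [pot, this]

theorem pot_E1 : pot E1 = 2 := by
  have : E1.edgeSet.ncard = 12 := by
    have : E1.edgeSet = (({s(0,1), s(1,2), s(2,3), s(3,4), s(4,5), s(5,6), s(6,7), s(7,8), s(8,0),
      s(9,0), s(9,3), s(9,6)} : Finset (Sym2 (Fin 10))) : Set (Sym2 (Fin 10))) := by
      rw [E1, SimpleGraph.edgeSet_fromEdgeSet, sdiff_eq_left.2]
      · simp
      · rw [Set.disjoint_left]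
        intro e he
        simp only [Set.mem_insert_iff, Set.mem_singleton_iff] at he
        rcases he with rfl|rfl|rfl|rfl|rfl|rfl|rfl|rfl|rfl|rfl|rfl|rfl <;> simp
    rw [this, Set.ncard_coe_finset]
    decide
  simp [pot, this]

theorem pot_E2 : pot E2 = 2 := by
  have : E2.edgeSet.ncard = 12 := by
    have : E2.edgeSet = (({s(0,1), s(1,2), s(2,3), s(3,4), s(4,0),
      s(1,5), s(5,6), s(6,7), s(7,0),
      s(3,8), s(8,9), s(9,6)} : Finset (Sym2 (Fin 10))) : Set (Sym2 (Fin 10))) := by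
      rw [E2, SimpleGraph.edgeSet_fromEdgeSet, sdiff_eq_left.2]
      · simp
      · rw [Set.disjoint_left]
        intro e he
        simp only [Set.mem_insert_iff, Set.mem_singleton_iff] at he
        rcases he with rfl|rfl|rfl|rfl|rfl|rfl|rfl|rfl|rfl|rfl|rfl|rfl <;> simp
    rw [this, Set.ncard_coe_finset]
    decide
  simp [pot, this]

theorem small_pot {V : Type} [Fintype V] {G : SimpleGraph V} (h : SmallestCex G)
    (m : ℕ) (H : SimpleGraph (Fin m)) (hH : Critical52 H) (hm : m < Fintype.card V) :
    pot H ≤ 2 ∨ (pot H = 3 ∧ m = 3) := by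
  by_cases h1 : Nonempty (H ≃g cycleGraph 3)
  · obtain ⟨I⟩ := h1
    right
    refine ⟨by rw [pot_iso I, pot_C3], ?_⟩
    simpa using Fintype.card_congr I.toEquiv
  by_cases h2 : Nonempty (H ≃g E1)
  · obtain ⟨I⟩ := h2
    left
    rw [pot_iso I, pot_E1]
  by_cases h3 : Nonempty (H ≃g E2)
  · obtain ⟨I⟩ := h3
    left
    rw [pot_iso I, pot_E2]
  rw [not_nonempty_iff] at h1 h2 h3
  have := h.2.2.2.2.2 m H hH h1 h2 h3 hm
  left; omega

theorem key_extend {V : Type} [Fintype V] {G : SimpleGraph V} (h : SmallestCex G)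
    (R : Finset V) (hne : R.Nonempty) (hR : R ≠ Finset.univ) (hp : potIn G R ≤ 4) :
    ∃ R' : Finset V, R ⊂ R' ∧
      (potIn G R' ≤ potIn G R - 3 ∨
        (potIn G R' ≤ potIn G R - 2 ∧ R'.card ≤ R.card + 2)) := by
  classical
  obtain ⟨φ, hφ⟩ := critical_color h.1 R hR
  let f : V → V ⊕ Fin 5 := fun v => if v ∈ R then Sum.inr (φ v) else Sum.inl v
  have fR : ∀ v, v ∈ R → f v = Sum.inr (φ v) := fun v hv => if_pos hv
  have fN : ∀ v, v ∉ R → f v = Sum.inl v := fun v hv => if_neg hv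
  have f_inl : ∀ v x, f v = Sum.inl x → v = x ∧ v ∉ R := by
    intro v x hv
    by_cases hvR : v ∈ R
    · rw [fR v hvR] at hv; cases hv
    · rw [fN v hvR] at hv; exact ⟨Sum.inl.inj hv, hvR⟩
  have f_inr : ∀ v c, f v = Sum.inr c → v ∈ R ∧ φ v = c := by
    intro v x hv
    by_cases hvR : v ∈ R
    · rw [fR v hvR] at hv; exact ⟨hvR, Sum.inr.inj hv⟩
    · rw [fN v hvR] at hv; cases hv
  have f_adj : ∀ u v, G.Adj u v → f u ≠ f v := by
    intro u v huv hf
    by_cases hu : u ∈ R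
    · rw [fR u hu] at hf
      obtain ⟨hv, hc⟩ := f_inr v _ hf.symm
      exact (hφ u hu v hv huv).ne hc.symm
    · rw [fN u hu] at hf
      exact huv.ne (f_inl v _ hf.symm).1.symm
  have f_ninj : ¬ Function.Injective f := by
    intro hinj
    have := potIn_ge_five G R hne φ (by
      intro u hu v hv huv
      apply hinj
      rw [fR u hu, fR v hv, huv]) hφ
    omega
  let G' : SimpleGraph (Set.range f) :=
    { Adj := fun x y => ∃ u v, f u = x.1 ∧ f v = y.1 ∧ G.Adj u v
      symm := ⟨by
        rintro x y ⟨u, v, hu, hv, huv⟩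
        exact ⟨v, u, hv, hu, huv.symm⟩⟩
      loopless := ⟨by
        rintro x ⟨u, v, hu, hv, huv⟩
        exact f_adj u v huv (hu.trans hv.symm)⟩ }
  have hG' : IsEmpty (G' →g cycleGraph 5) := by
    constructor
    intro g
    exact h.1.1.false ⟨fun v => g ⟨f v, v, rfl⟩,
      fun {u v} huv => g.map_rel ⟨u, v, rfl, rfl, huv⟩⟩
  obtain ⟨m, H, ι0, hι0, hadj0, hH⟩ := exists_critical G' hG'
  let ι : Fin m → V ⊕ Fin 5 := fun i => (ι0 i).1
  have hι : Function.Injective ι := Subtype.val_injective.comp hι0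
  have hιr : ∀ i, ∃ v, f v = ι i := fun i => (ι0 i).2
  have hadj : ∀ i j, H.Adj i j → ∃ u v, f u = ι i ∧ f v = ι j ∧ G.Adj u v := hadj0
  have hm : m < Fintype.card V := by
    have h1 : m ≤ Fintype.card (Set.range f) := by
      simpa using Fintype.card_le_of_injective ι0 hι0
    have h2 : Fintype.card (Set.range f) < Fintype.card V := by
      refine lt_of_le_of_ne (Fintype.card_range_le f) ?_
      intro heq
      apply f_ninj
      have hb := (Fintype.bijective_iff_surjective_and_card (Set.rangeFactorization f)).2
        ⟨Set.rangeFactorization_surjective, heq.symm⟩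
      intro u v huv
      exact hb.1 (Subtype.ext huv)
    omega
  let X : Finset (Fin m) := Finset.univ.filter (fun i => ∃ c, ι i = Sum.inr c)
  have memX : ∀ i, i ∈ X ↔ ∃ c, ι i = Sum.inr c := by intro i; simp [X]
  let R' : Finset V := Finset.univ.filter (fun v => v ∈ R ∨ ∃ i, ι i = f v)
  have memR' : ∀ v, v ∈ R' ↔ v ∈ R ∨ ∃ i, ι i = f v := by intro i; simp [R']
  have hsub : R ⊆ R' := fun v hv => (memR' v).2 (Or.inl hv)
  -- colouring of the part of `H` inside the contracted set
  let ψ : Fin m → Fin 5 := fun i => Sum.elim (fun _ => 0) id (ι i)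
  have hψ : ∀ i c, ι i = Sum.inr c → ψ i = c := by
    intro i c hc
    simp [ψ, hc]
  have hψadj : ∀ i ∈ X, ∀ j ∈ X, H.Adj i j → (cycleGraph 5).Adj (ψ i) (ψ j) := by
    intro i hi j hj hij
    obtain ⟨c, hc⟩ := (memX i).1 hi
    obtain ⟨d, hd⟩ := (memX j).1 hj
    obtain ⟨u, v, hu, hv, huv⟩ := hadj i j hij
    obtain ⟨a, a'⟩ := f_inr u c (hu.trans hc)
    obtain ⟨b, b'⟩ := f_inr v d (hv.trans hd)
    rw [hψ i c hc, hψ j d hd, ← a', ← b']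
    exact hφ u a v b huv
  have hXne : X.Nonempty := by
    by_contra hX
    rw [Finset.not_nonempty_iff_eq_empty] at hX
    have hl : ∀ i, ∃ v, ι i = Sum.inl v := by
      intro i
      rcases hi : ι i with v | c
      · exact ⟨v, rfl⟩
      · have : i ∈ X := (memX i).2 ⟨c, hi⟩
        simp [hX] at this
    choose g hg using hl
    obtain ⟨χ, hχ⟩ := critical_color h.1 (Finset.univ \ R) (by
      intro hh
      obtain ⟨r, hr⟩ := hne
      have : r ∈ Finset.univ \ R := by rw [hh]; simp
      simp [hr] at this)
    refine hH.1.false ⟨fun i => χ (g i), ?_⟩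
    intro i j hij
    obtain ⟨u, v, hu, hv, huv⟩ := hadj i j hij
    obtain ⟨a, a'⟩ := f_inl u _ (hu.trans (hg i))
    obtain ⟨b, b'⟩ := f_inl v _ (hv.trans (hg j))
    rw [← a, ← b]
    exact hχ u (by simp [a']) v (by simp [b']) huv
  have hne' : R ≠ R' := by
    intro heq
    have hXall : ∀ i, i ∈ X := by
      intro i
      obtain ⟨v, hv⟩ := hιr i
      have : v ∈ R := by rw [heq]; exact (memR' v).2 (Or.inr ⟨i, hv.symm⟩)
      exact (memX i).2 ⟨φ v, by rw [← hv, fR v this]⟩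
    exact hH.1.false ⟨ψ, fun {i j} hij => hψadj i (hXall i) j (hXall j) hij⟩
  have hpX : 5 ≤ potIn H X := by
    refine potIn_ge_five H X hXne ψ ?_ hψadj
    intro i hi j hj hij
    obtain ⟨c, hc⟩ := (memX i).1 hi
    obtain ⟨d, hd⟩ := (memX j).1 hj
    rw [hψ i c hc, hψ j d hd] at hij
    apply hι
    rw [hc, hd, hij]
  -- vertex count
  have hvert : R'.card + X.card ≤ R.card + m := by
    have h1 : (R' \ R).card ≤ ((Finset.univ \ X).image ι).card := by
      apply Finset.card_le_card_of_injOn f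
      · intro v hv
        have hv' := Finset.mem_sdiff.1 hv
        rcases (memR' v).1 hv'.1 with hr | ⟨i, hi⟩
        · exact absurd hr hv'.2
        · rw [← hi]
          refine Finset.mem_coe.2 (Finset.mem_image_of_mem _ ?_)
          simp only [Finset.mem_sdiff, Finset.mem_univ, true_and, memX]
          rintro ⟨c, hc⟩
          rw [hi, fN v hv'.2] at hc
          cases hc
      · intro u hu v hv huv
        rw [fN u (Finset.mem_sdiff.1 hu).2, fN v (Finset.mem_sdiff.1 hv).2] at huv
        exact Sum.inl.inj huv
    have h2 := Finset.card_image_le (s := Finset.univ \ X) (f := ι)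
    have h3 := Finset.card_sdiff_add_card_eq_card hsub
    have h4 := Finset.card_sdiff_add_card_eq_card (Finset.subset_univ X)
    simp only [Finset.card_univ, Fintype.card_fin] at h4
    omega
  -- edge count
  have hmono : edgesIn G R ⊆ edgesIn G R' := by
    intro e he
    rw [mem_edgesIn] at he ⊢
    exact ⟨he.1, fun x hx => hsub (he.2 x hx)⟩
  have hmonoX : edgesIn H X ⊆ edgesIn H Finset.univ := by
    intro e he
    rw [mem_edgesIn] at he ⊢
    exact ⟨he.1, fun x hx => Finset.mem_univ _⟩
  have hedge : (edgesIn H Finset.univ).card + (edgesIn G R).card ≤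
      (edgesIn G R').card + (edgesIn H X).card := by
    have h1 : ((edgesIn H Finset.univ \ edgesIn H X).image (Sym2.map ι)) ⊆
        ((edgesIn G R' \ edgesIn G R).image (Sym2.map f)) := by
      intro e he
      obtain ⟨e0, he0, rfl⟩ := Finset.mem_image.1 he
      clear he
      induction e0 using Sym2.ind with
      | _ i j =>
        rw [Finset.mem_sdiff, mk_mem_edgesIn, mk_mem_edgesIn] at he0
        obtain ⟨u, v, hu, hv, huv⟩ := hadj i j he0.1.1
        refine Finset.mem_image.2 ⟨s(u, v), ?_, by simp [hu, hv]⟩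
        rw [Finset.mem_sdiff, mk_mem_edgesIn, mk_mem_edgesIn]
        refine ⟨⟨huv, (memR' u).2 (Or.inr ⟨i, hu.symm⟩), (memR' v).2 (Or.inr ⟨j, hv.symm⟩)⟩, ?_⟩
        rintro ⟨-, a, b⟩
        refine he0.2 ⟨he0.1.1, (memX i).2 ⟨φ u, ?_⟩, (memX j).2 ⟨φ v, ?_⟩⟩
        · rw [← hu, fR u a]
        · rw [← hv, fR v b]
    have h2 := Finset.card_le_card h1
    rw [Finset.card_image_of_injective _ (Sym2.map.injective hι)] at h2
    have h3 := Finset.card_image_le (s := edgesIn G R' \ edgesIn G R) (f := Sym2.map f)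
    have h4 := Finset.card_sdiff_add_card_eq_card hmono
    have h5 := Finset.card_sdiff_add_card_eq_card hmonoX
    omega
  have hpH : pot H = 5 * (m : ℤ) - 4 * ((edgesIn H Finset.univ).card : ℤ) := by
    rw [← potIn_univ]; simp [potIn]
  have hXc := hXne.card_pos
  refine ⟨R', Finset.ssubset_iff_subset_ne.2 ⟨hsub, hne'⟩, ?_⟩
  have hsmall := small_pot h m H hH hm
  unfold potIn at *
  omega

theorem proper_pot {V : Type} [Fintype V] {G : SimpleGraph V} (h : SmallestCex G) :
    ∀ (k : ℕ) (R : Finset V), Fintype.card V - R.card ≤ k → R.Nonempty → R ≠ Finset.univ →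
      4 ≤ potIn G R := by
  intro k
  induction k with
  | zero =>
    intro R hk _ hR
    exfalso
    apply hR
    rw [← Finset.card_eq_iff_eq_univ]
    have := Finset.card_le_univ R
    omega
  | succ k ih =>
    intro R hk hne hR
    by_contra hcon
    obtain ⟨R', hss, hp⟩ := key_extend h R hne hR (by omega)
    have hp' : potIn G R' ≤ 1 := by omega
    have hc := Finset.card_lt_card hss
    by_cases hR' : R' = Finset.univ
    · rw [hR', potIn_univ] at hp'
      have := h.2.2.2.2.1
      omega
    · have := ih R' (by omega) (hne.mono hss.1) hR'
      omega

theorem no_triangle {V : Type} [Fintype V] {G : SimpleGraph V} (h : SmallestCex G)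
    (a b c : V) (hab : G.Adj a b) (hbc : G.Adj b c) (hca : G.Adj c a) : False := by
  classical
  by_cases hu : ({a, b, c} : Finset V) = Finset.univ
  · have hcard : Fintype.card V = 3 := by
      rw [← Finset.card_univ, ← hu, Finset.card_eq_three]
      exact ⟨a, b, c, hab.ne, hca.ne.symm, hbc.ne, rfl⟩
    have hall : ∀ x : V, x = a ∨ x = b ∨ x = c := by
      intro x
      have : x ∈ ({a, b, c} : Finset V) := by rw [hu]; simp
      simpa using this
    have htop : G = ⊤ := by
      ext x y
      rw [SimpleGraph.top_adj]
      refine ⟨fun h => h.ne, fun hxy => ?_⟩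
      rcases hall x with rfl | rfl | rfl <;> rcases hall y with rfl | rfl | rfl <;>
        first
        | exact absurd rfl hxy
        | assumption
        | (apply SimpleGraph.Adj.symm; assumption)
    apply h.2.1.false
    rw [htop, SimpleGraph.cycleGraph_three_eq_top]
    exact SimpleGraph.Iso.completeGraph (Fintype.equivFinOfCardEq hcard)
  · obtain ⟨φ, hφ⟩ := critical_color h.1 _ hu
    have h1 := hφ a (by simp) b (by simp) hab
    have h2 := hφ b (by simp) c (by simp) hbc
    have h3 := hφ c (by simp) a (by simp) hca
    have : ∀ x y z : Fin 5, (cycleGraph 5).Adj x y → (cycleGraph 5).Adj y z →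
      (cycleGraph 5).Adj z x → False := by decide
    exact this _ _ _ h1 h2 h3

theorem no_four_cycle {V : Type} [Fintype V] {G : SimpleGraph V} (h : SmallestCex G)
    (a b c d : V) (hab : G.Adj a b) (hbc : G.Adj b c) (hcd : G.Adj c d) (hda : G.Adj d a)
    (hac : a ≠ c) (hbd : b ≠ d) : False := by
  classical
  have nac : ¬ G.Adj a c := fun hh => no_triangle h a b c hab hbc hh.symm
  have nbd : ¬ G.Adj b d := fun hh => no_triangle h b c d hbc hcd hh.symm
  have out : ∀ x y z t : V, G.Adj x y → G.Adj y z → G.Adj z t → G.Adj t x → x ≠ z →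
      ¬ G.Adj x z → ∃ w, G.Adj x w ∧ w ≠ x ∧ w ≠ y ∧ w ≠ z ∧ w ≠ t := by
    intro x y z t hxy hyz hzt htx hxz nxz
    obtain ⟨w, hw, hw'⟩ := critical_nondom h.1 x z hxz
    refine ⟨w, hw, hw.ne.symm, ?_, ?_, ?_⟩
    · rintro rfl; exact hw' hyz.symm
    · rintro rfl; exact nxz hw
    · rintro rfl; exact hw' hzt
  obtain ⟨wa, ha, ha1, ha2, ha3, ha4⟩ := out a b c d hab hbc hcd hda hac nac
  obtain ⟨wb, hb, hb1, hb2, hb3, hb4⟩ := out b c d a hbc hcd hda hab hbd nbd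
  obtain ⟨wc, hc, hc1, hc2, hc3, hc4⟩ := out c d a b hcd hda hab hbc hac.symm (fun hh => nac hh.symm)
  obtain ⟨wd, hd, hd1, hd2, hd3, hd4⟩ := out d a b c hda hab hbc hcd hbd.symm (fun hh => nbd hh.symm)
  have n1 := hab.ne
  have n2 := hbc.ne
  have n3 := hcd.ne
  have n4 := hda.ne
  have hRu : ({a, b, c, d} : Finset V) ≠ Finset.univ := by
    intro hh
    have : wa ∈ ({a, b, c, d} : Finset V) := by rw [hh]; simp
    simp [ha1, ha2, ha3, ha4] at this
  have hRc : ({a, b, c, d} : Finset V).card = 4 := by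
    repeat rw [Finset.card_insert_of_notMem (by simp only [Finset.mem_insert, Finset.mem_singleton]; grind)]
    simp
  have hRe : 4 ≤ (edgesIn G {a, b, c, d}).card := by
    have h1 : ({s(a,b), s(b,c), s(c,d), s(d,a)} : Finset (Sym2 V)) ⊆ edgesIn G {a, b, c, d} := by
      intro e he
      simp only [Finset.mem_insert, Finset.mem_singleton] at he
      rcases he with rfl | rfl | rfl | rfl <;> rw [mk_mem_edgesIn] <;> simp [*]
    have h2 : ({s(a,b), s(b,c), s(c,d), s(d,a)} : Finset (Sym2 V)).card = 4 := by
      repeat rw [Finset.card_insert_of_notMem (by simp only [Finset.mem_insert, Finset.mem_singleton, Sym2.eq_iff]; grind)]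
      simp
    have := Finset.card_le_card h1
    omega
  have hE : 8 ≤ (edgesIn G Finset.univ).card := by
    have h1 : ({s(a,b), s(b,c), s(c,d), s(d,a), s(a,wa), s(b,wb), s(c,wc), s(d,wd)} :
        Finset (Sym2 V)) ⊆ edgesIn G Finset.univ := by
      intro e he
      simp only [Finset.mem_insert, Finset.mem_singleton] at he
      rcases he with rfl | rfl | rfl | rfl | rfl | rfl | rfl | rfl <;> rw [mk_mem_edgesIn] <;>
        simp [*]
    have h2 : ({s(a,b), s(b,c), s(c,d), s(d,a), s(a,wa), s(b,wb), s(c,wc), s(d,wd)} :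
        Finset (Sym2 V)).card = 8 := by
      repeat rw [Finset.card_insert_of_notMem (by simp only [Finset.mem_insert, Finset.mem_singleton, Sym2.eq_iff]; grind)]
      simp
    have := Finset.card_le_card h1
    omega
  have hp : potIn G {a, b, c, d} ≤ 4 := by
    unfold potIn
    omega
  obtain ⟨R', hss, hR'⟩ := key_extend h {a, b, c, d} (by simp) hRu hp
  have hG := h.2.2.2.2.1
  by_cases hu : R' = Finset.univ
  · subst hu
    rw [potIn_univ] at hR'
    have := potIn_univ G
    unfold potIn at this hp hR'
    omega
  · have := proper_pot h _ R' le_rfl ((Finset.insert_nonempty _ _).mono hss.1) hu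
    omega

/-- Every smallest counterexample has girth at least 5:
it contains no cycle of length 3 or 4. -/
theorem smallestCex_girth_ge_five {V : Type} [Fintype V] (G : SimpleGraph V)
    (h : SmallestCex G) :
    ∀ (v : V) (c : G.Walk v v), c.IsCycle → c.length ≠ 3 ∧ c.length ≠ 4 := by
  intro v c hc
  constructor
  · intro hl
    match c, hl with
    | .cons h1 (.cons h2 (.cons h3 .nil)), _ => exact no_triangle h _ _ _ h1 h2 h3
  · intro hl
    match c, hl, hc with
    | .cons h1 (.cons h2 (.cons h3 (.cons h4 .nil))), _, hc =>
      have := hc.support_nodup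
      simp at this
      refine no_four_cycle h _ _ _ _ h1 h2 h3 h4 ?_ ?_ <;> grind
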